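/- arXiv:2303.18128 — 7 statements merged into one kernel-verified Lean document; each statement's English description precedes it below -/
import Mathlib

section
/- Every relative value iteration iterate is strictly increasing in the AoII variable on positive AoII states: for every iteration index t ∈ ℕ, every transmission count r ∈ ℕ, and all 1 ≤ δ⁻ < δ⁺, one has V_t(δ⁺, r) > V_t(δ⁻, r). -/
/-- The Bellman operator of the Lagrangian MDP for AoII with HARQ. -/
noncomputable def bellmanT (α μ lam : ℝ) (p f : ℕ → ℝ) (V : ℕ → ℕ → ℝ) :
    ℕ → ℕ → ℝ := fun δ r =>
  if δ = 0 then
    f 0 + min (α * V 0 0 + (1 - α) * V 1 0)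
              (lam + α * V 0 0 + (1 - α) * V 1 0)
  else
    f δ + min ((1 - μ) * V (δ + 1) 0 + μ * V 0 0)
              (lam + (α * (1 - p r)) * V (δ + 1) (r + 1)
                   + (1 - α - μ * (1 - p r)) * V (δ + 1) 0
                   + (1 - α * (1 - p r) - (1 - α - μ * (1 - p r))) * V 0 0)

/-- The relative value iteration iterates, anchored at the state (0,0),
with initialization V₀(δ, r) = f(δ). -/
noncomputable def rvi (α μ lam : ℝ) (p f : ℕ → ℝ) : ℕ → ℕ → ℕ → ℝ
  | 0 => fun δ _ => f δ
  | t + 1 => fun δ r =>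
      bellmanT α μ lam p f (rvi α μ lam p f t) δ r
        - bellmanT α μ lam p f (rvi α μ lam p f t) 0 0

/-- Every relative value iteration iterate is strictly increasing in
the AoII variable on positive AoII states: for every iteration index t, every
transmission count r, and all 1 ≤ δ⁻ < δ⁺, one has V_t(δ⁺, r) > V_t(δ⁻, r). -/
theorem rvi_strictMono_in_aoii
    (α μ lam : ℝ) (p f : ℕ → ℝ)
    (hα0 : 0 < α) (hα1 : α < 1) (hμ0 : 0 < μ) (hαμ : α + μ ≤ 1)
    (hp : ∀ r, 0 < p r ∧ p r < 1) (hpmono : Monotone p)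
    (hlam : 0 ≤ lam) (hf : StrictMono f) :
    ∀ (t r δm δp : ℕ), 1 ≤ δm → δm < δp →
      rvi α μ lam p f t δm r < rvi α μ lam p f t δp r := by
  intro t
  induction t with
  | zero => exact fun _ _ _ _ h => hf h
  | succ t ih =>
    intro r δm δp hm hlt
    obtain ⟨hp0, hp1⟩ := hp r
    simp only [rvi]
    refine sub_lt_sub_right ?_ _
    have hV0 := (ih 0 (δm + 1) (δp + 1) (by omega) (by omega)).le
    have hV1 := (ih (r + 1) (δm + 1) (δp + 1) (by omega) (by omega)).le
    have hγ₁ : 0 ≤ α * (1 - p r) := mul_nonneg hα0.le (by linarith)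
    have hγ₂ : 0 ≤ 1 - α - μ * (1 - p r) := by nlinarith
    have hμ1 : 0 ≤ 1 - μ := by linarith
    have hfδ := hf hlt
    simp only [bellmanT, if_neg (show δm ≠ 0 by omega), if_neg (show δp ≠ 0 by omega)]
    refine add_lt_add_of_lt_of_le hfδ (min_le_min ?_ ?_) <;> gcongr
end

section
/- For every h ∈ ℕ, the row sums of the h-th matrix power are nonincreasing in the row index: σ(h, r') ≤ σ(h, r) whenever r ≤ r'. -/
/-- The r-th row sum of the h-th power of the substochastic matrix P on ℕ with
entries P(r, 0) = γ₂(r), P(r, r+1) = γ₁(r), where γ₁(r) = α(1 − p(r)) and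
γ₂(r) = 1 − α − μ(1 − p(r)). -/
noncomputable def rowSum (α μ : ℝ) (p : ℕ → ℝ) : ℕ → ℕ → ℝ
  | 0, _ => 1
  | h + 1, r =>
      (1 - α - μ * (1 - p r)) * rowSum α μ p h 0
        + (α * (1 - p r)) * rowSum α μ p h (r + 1)

theorem rowSum_succ_eq (α μ : ℝ) (p : ℕ → ℝ) (h r : ℕ) :
    rowSum α μ p (h + 1) r = (1 - α) * rowSum α μ p h 0
      + (1 - p r) * (α * rowSum α μ p h (r + 1) - μ * rowSum α μ p h 0) := by
  rw [rowSum]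
  ring

/-- Antitonicity in the row, strengthened by the lower bound `μ σ(h, 0) ≤ α σ(h, r)` so that
it can be proved by induction on `h`. -/
theorem rowSum_nonneg_and_antitone_and_le
    (α μ : ℝ) (p : ℕ → ℝ)
    (hμ0 : 0 < μ) (hμα : μ < α) (hα1 : α < 1) (hαμ : α + μ ≤ 1)
    (hp : ∀ r, 0 < p r ∧ p r < 1) (hpmono : Monotone p) (h : ℕ) :
    0 ≤ rowSum α μ p h 0 ∧ Antitone (rowSum α μ p h) ∧
      ∀ r, μ * rowSum α μ p h 0 ≤ α * rowSum α μ p h r := by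
  have hα0 : 0 < α := hμ0.trans hμα
  induction h with
  | zero => exact ⟨by simp [rowSum], fun _ _ _ => by simp [rowSum], fun _ => by
      simpa [rowSum] using hμα.le⟩
  | succ h ih =>
    obtain ⟨hnonneg, hanti, hle⟩ := ih
    have lower (r : ℕ) : (1 - α) * rowSum α μ p h 0 ≤ rowSum α μ p (h + 1) r := by
      rw [rowSum_succ_eq]
      have := mul_nonneg (sub_nonneg.2 (hp r).2.le) (sub_nonneg.2 (hle (r + 1)))
      linarith
    have upper : rowSum α μ p (h + 1) 0 ≤ (1 - μ) * rowSum α μ p h 0 := by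
      rw [rowSum_succ_eq]
      have h₁ := mul_le_of_le_one_left (sub_nonneg.2 (hle (0 + 1)))
        (sub_le_self 1 (hp 0).1.le)
      have h₂ := mul_le_mul_of_nonneg_left (hanti (Nat.zero_le (0 + 1))) hα0.le
      linarith
    refine ⟨(mul_nonneg (sub_nonneg.2 hα1.le) hnonneg).trans (lower 0), ?_, fun r => ?_⟩
    · intro r r' hr
      rw [rowSum_succ_eq, rowSum_succ_eq]
      have h₁ : rowSum α μ p h (r' + 1) ≤ rowSum α μ p h (r + 1) :=
        hanti (Nat.succ_le_succ hr)
      have h₂ : 1 - p r' ≤ 1 - p r := sub_le_sub_left (hpmono hr) 1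
      have h₃ := sub_nonneg.2 (hle (r' + 1))
      have h₄ := sub_nonneg.2 (hp r).2.le
      gcongr
    · calc μ * rowSum α μ p (h + 1) 0
          ≤ μ * ((1 - μ) * rowSum α μ p h 0) := by gcongr
        _ ≤ α * ((1 - α) * rowSum α μ p h 0) := by
          have := mul_nonneg (mul_nonneg (sub_nonneg.2 hμα.le) (sub_nonneg.2 hαμ)) hnonneg
          linarith
        _ ≤ α * rowSum α μ p (h + 1) r := by gcongr; exact lower r

/-- For every h, the row sums of the h-th matrix power are
nonincreasing in the row index: σ(h, r') ≤ σ(h, r) whenever r ≤ r'. -/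
theorem rowSum_antitone_in_row
    (α μ : ℝ) (p : ℕ → ℝ)
    (hμ0 : 0 < μ) (hμα : μ < α) (hα1 : α < 1) (hαμ : α + μ ≤ 1)
    (hp : ∀ r, 0 < p r ∧ p r < 1) (hpmono : Monotone p) :
    ∀ h r r' : ℕ, r ≤ r' → rowSum α μ p h r' ≤ rowSum α μ p h r := by
  intro h r r' hr
  exact (rowSum_nonneg_and_antitone_and_le α μ p hμ0 hμα hα1 hαμ hp hpmono h).2.1 hr
end

section
/- For every h ∈ ℕ and every r ∈ ℕ, α·σ(h, r+1) − μ·σ(h, 0) ≥ 0; that is, the bracketed term in the row-sum recursion σ(h+1, r) = (1 − α)·σ(h, 0) + (1 − p(r))·(α·σ(h, r+1) − μ·σ(h, 0)) is always nonnegative. -/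
/-- The row sums are nonnegative and antitone in the row index, and the bracket in their
recursion is nonnegative. -/
theorem rowSum_nonneg_and_antitone_and_bracket_nonneg
    {α μ : ℝ} {p : ℕ → ℝ}
    (hμ0 : 0 ≤ μ) (hμα : μ ≤ α) (hα1 : α ≤ 1) (hαμ : α + μ ≤ 1)
    (hp0 : ∀ r, 0 ≤ p r) (hp1 : ∀ r, p r ≤ 1) (hpmono : Monotone p) (h : ℕ) :
    0 ≤ rowSum α μ p h 0 ∧
      (∀ r, rowSum α μ p h (r + 1) ≤ rowSum α μ p h r) ∧
      ∀ r, 0 ≤ α * rowSum α μ p h (r + 1) - μ * rowSum α μ p h 0 := by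
  have hα0 : 0 ≤ α := hμ0.trans hμα
  induction h with
  | zero => simp [rowSum, hμα]
  | succ h ih =>
    obtain ⟨hs, hanti, hB⟩ := ih
    have lower (r : ℕ) : (1 - α) * rowSum α μ p h 0 ≤ rowSum α μ p (h + 1) r := by
      rw [rowSum_succ_eq]
      exact le_add_of_nonneg_right (mul_nonneg (sub_nonneg.2 (hp1 r)) (hB r))
    have upper : rowSum α μ p (h + 1) 0 ≤ (1 - μ) * rowSum α μ p h 0 := by
      rw [rowSum_succ_eq]
      have h1 := mul_le_of_le_one_left (hB 0) (sub_le_self 1 (hp0 0))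
      have h2 := mul_le_mul_of_nonneg_left (hanti 0) hα0
      linarith
    refine ⟨(mul_nonneg (sub_nonneg.2 hα1) hs).trans (lower 0), fun r => ?_, fun r => ?_⟩
    · rw [rowSum_succ_eq, rowSum_succ_eq]
      have hq : 1 - p (r + 1) ≤ 1 - p r := sub_le_sub_left (hpmono r.le_succ) 1
      have h2 := mul_le_mul_of_nonneg_left (hanti (r + 1)) hα0
      have := mul_le_mul hq (sub_le_sub_right h2 (μ * rowSum α μ p h 0)) (hB (r + 1))
        (sub_nonneg.2 (hp1 r))
      linarith
    · have h1 := mul_le_mul_of_nonneg_left (lower (r + 1)) hα0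
      have h2 := mul_le_mul_of_nonneg_left upper hμ0
      have h3 : 0 ≤ (α - μ) * (1 - α - μ) * rowSum α μ p h 0 :=
        mul_nonneg (mul_nonneg (by linarith) (by linarith)) hs
      linarith

/-- For every h and r, α·σ(h, r+1) − μ·σ(h, 0) ≥ 0; that is, the
bracketed term in the row-sum recursion
σ(h+1, r) = (1 − α)·σ(h, 0) + (1 − p(r))·(α·σ(h, r+1) − μ·σ(h, 0))
is always nonnegative. -/
theorem rowSum_bracket_nonneg
    (α μ : ℝ) (p : ℕ → ℝ)
    (hμ0 : 0 < μ) (hμα : μ < α) (hα1 : α < 1) (hαμ : α + μ ≤ 1)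
    (hp : ∀ r, 0 < p r ∧ p r < 1) (hpmono : Monotone p) :
    ∀ h r : ℕ,
      0 ≤ α * rowSum α μ p h (r + 1) - μ * rowSum α μ p h 0 ∧
      rowSum α μ p (h + 1) r
        = (1 - α) * rowSum α μ p h 0
          + (1 - p r) * (α * rowSum α μ p h (r + 1) - μ * rowSum α μ p h 0) := by
  exact fun h r =>
    ⟨(rowSum_nonneg_and_antitone_and_bracket_nonneg hμ0.le hμα.le hα1.le hαμ
      (fun r => (hp r).1.le) (fun r => (hp r).2.le) hpmono h).2.2 r, rowSum_succ_eq α μ p h r⟩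
end

section
/- The series expansion solves the transmit-region value recursion: defining W(δ, r) = Σ_{l=0}^∞ (f(δ + l) + λ − g)·σ(l, r) (the series converges absolutely for every δ ≥ 1 and r), one has, for every δ ≥ 1 and every r ∈ ℕ, W(δ, r) = (f(δ) + λ − g) + γ₁(r)·W(δ+1, r+1) + γ₂(r)·W(δ+1, 0). -/
theorem rowSum_nonneg {α μ : ℝ} {p : ℕ → ℝ} (h₁ : ∀ r, 0 ≤ α * (1 - p r))
    (h₂ : ∀ r, 0 ≤ 1 - α - μ * (1 - p r)) (l r : ℕ) : 0 ≤ rowSum α μ p l r := by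
  induction l generalizing r with
  | zero => simp [rowSum]
  | succ l ih =>
    exact add_nonneg (mul_nonneg (h₂ r) (ih 0)) (mul_nonneg (h₁ r) (ih (r + 1)))

theorem rowSum_le_pow {α μ c : ℝ} {p : ℕ → ℝ} (h₁ : ∀ r, 0 ≤ α * (1 - p r))
    (h₂ : ∀ r, 0 ≤ 1 - α - μ * (1 - p r)) (hc : 0 ≤ c)
    (hle : ∀ r, α * (1 - p r) + (1 - α - μ * (1 - p r)) ≤ c) (l r : ℕ) :
    rowSum α μ p l r ≤ c ^ l := by
  induction l generalizing r with
  | zero => simp [rowSum]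
  | succ l ih =>
    calc rowSum α μ p (l + 1) r
        ≤ (1 - α - μ * (1 - p r)) * c ^ l + α * (1 - p r) * c ^ l :=
          add_le_add (mul_le_mul_of_nonneg_left (ih 0) (h₂ r))
            (mul_le_mul_of_nonneg_left (ih (r + 1)) (h₁ r))
      _ = (α * (1 - p r) + (1 - α - μ * (1 - p r))) * c ^ l := by ring
      _ ≤ c * c ^ l := mul_le_mul_of_nonneg_right (hle r) (pow_nonneg hc l)
      _ = c ^ (l + 1) := (pow_succ' c l).symm

theorem summable_shift_mul_pow {f : ℕ → ℝ} {c : ℝ} (hc : c ≠ 0) {a : ℕ}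
    (h : Summable fun l => f (a + l) * c ^ l) (k : ℕ) :
    Summable fun l => f (a + k + l) * c ^ l := by
  refine (((summable_nat_add_iff k).2 h).mul_right (c ^ k)⁻¹).congr fun l => ?_
  rw [show a + (l + k) = a + k + l by omega, pow_add]
  field_simp

/-- The series expansion
W(δ, r) = Σ_{l=0}^∞ (f(δ + l) + λ − g)·σ(l, r) converges absolutely for every
δ ≥ 1 and r, and solves the transmit-region value recursion
W(δ, r) = (f(δ) + λ − g) + γ₁(r)·W(δ+1, r+1) + γ₂(r)·W(δ+1, 0). -/
theorem transmit_value_series_recursion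
    (α μ lam g : ℝ) (p : ℕ → ℝ) (f : ℕ → ℝ) (W : ℕ → ℕ → ℝ)
    (hμ0 : 0 < μ) (hμα : μ < α) (hα1 : α < 1) (hαμ : α + μ ≤ 1)
    (hp : ∀ r, 0 < p r ∧ p r < 1) (hpmono : Monotone p)
    (hlam : 0 ≤ lam)
    (hfnonneg : ∀ k, 0 ≤ f k) (hfmono : Monotone f)
    (hfsum : Summable
      (fun l => f (l + 1) * (α * (1 - p 0) + (1 - α - μ * (1 - p 0))) ^ l))
    (hW : ∀ δ r, W δ r = ∑' l : ℕ, (f (δ + l) + lam - g) * rowSum α μ p l r) :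
    ∀ δ r : ℕ, 1 ≤ δ →
      Summable (fun l => |(f (δ + l) + lam - g) * rowSum α μ p l r|) ∧
      W δ r = (f δ + lam - g)
        + (α * (1 - p r)) * W (δ + 1) (r + 1)
        + (1 - α - μ * (1 - p r)) * W (δ + 1) 0 := by
  have h₁ : ∀ r, 0 ≤ α * (1 - p r) := fun r =>
    mul_nonneg (by linarith) (by linarith [(hp r).2])
  have h₂ : ∀ r, 0 ≤ 1 - α - μ * (1 - p r) := fun r => by
    nlinarith [mul_pos hμ0 (hp r).1]
  set c := α * (1 - p 0) + (1 - α - μ * (1 - p 0)) with hc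
  have hle : ∀ r, α * (1 - p r) + (1 - α - μ * (1 - p r)) ≤ c := fun r => by
    nlinarith [mul_nonneg (sub_nonneg.2 hμα.le) (sub_nonneg.2 (hpmono (Nat.zero_le r)))]
  have hc0 : 0 < c := by
    nlinarith [mul_pos (sub_pos.2 hμα) (sub_pos.2 (hp 0).2)]
  have hc1 : c < 1 := by
    nlinarith [mul_pos (sub_pos.2 hμα) (hp 0).1]
  have hsum : ∀ δ r : ℕ, 1 ≤ δ →
      Summable (fun l => |(f (δ + l) + lam - g) * rowSum α μ p l r|) := by
    intro δ r hδ
    obtain ⟨k, rfl⟩ := Nat.exists_eq_add_of_le hδ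
    have hf : Summable fun l => f (1 + k + l) * c ^ l :=
      summable_shift_mul_pow hc0.ne' (by simpa only [add_comm 1] using hfsum) k
    have hgeo := (summable_geometric_of_lt_one hc0.le hc1).mul_left |lam - g|
    refine Summable.of_nonneg_of_le (fun _ => abs_nonneg _) (fun l => ?_) (hf.add hgeo)
    rw [abs_mul, abs_of_nonneg (rowSum_nonneg h₁ h₂ l r), ← add_mul, add_sub_assoc]
    have habs := abs_add_le (f (1 + k + l)) (lam - g)
    rw [abs_of_nonneg (hfnonneg _)] at habs
    exact mul_le_mul habs (rowSum_le_pow h₁ h₂ hc0.le hle l r)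
      (rowSum_nonneg h₁ h₂ l r) (add_nonneg (hfnonneg _) (abs_nonneg _))
  intro δ r hδ
  refine ⟨hsum δ r hδ, ?_⟩
  have hδ' : 1 ≤ δ + 1 := by omega
  rw [hW δ, hW (δ + 1) (r + 1), hW (δ + 1) 0, (hsum δ r hδ).of_abs.tsum_eq_zero_add,
    ← tsum_mul_left, ← tsum_mul_left, add_assoc,
    ← ((hsum (δ + 1) (r + 1) hδ').of_abs.mul_left _).tsum_add
      ((hsum (δ + 1) 0 hδ').of_abs.mul_left _)]
  congr 1
  · simp [rowSum]
  · refine tsum_congr fun l => ?_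
    rw [rowSum, show δ + (l + 1) = δ + 1 + l by omega]
    ring
end

section
/- If in addition f(δ) + λ − g ≥ 0 for a given δ ≥ 1, then the transmit-region value W(δ, r) = Σ_{l=0}^∞ (f(δ + l) + λ − g)·σ(l, r) is nonincreasing in the transmission count: W(δ, r') ≤ W(δ, r) whenever r ≤ r'. -/
/-- Row sums are nonnegative, nonincreasing in the row index, and decay slowly enough along the
rows that `μ σ(h, 0) ≤ α σ(h, r)`. -/
theorem rowSum_nonneg_and_antitone_and_ratio {α μ : ℝ} {p : ℕ → ℝ}
    (hμ0 : 0 < μ) (hμα : μ < α) (hαμ : α + μ ≤ 1)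
    (hp : ∀ r, 0 < p r ∧ p r < 1) (hpmono : Monotone p) (h : ℕ) :
    (∀ r, 0 ≤ rowSum α μ p h r) ∧ Antitone (rowSum α μ p h) ∧
      ∀ r, μ * rowSum α μ p h 0 ≤ α * rowSum α μ p h r := by
  have hα0 : 0 < α := hμ0.trans hμα
  induction h with
  | zero =>
    refine ⟨fun r => by simp [rowSum], fun a b _ => by simp [rowSum], fun r => ?_⟩
    simpa [rowSum] using hμα.le
  | succ h ih =>
    obtain ⟨hnonneg, hanti, hratio⟩ := ih
    refine ⟨fun r => ?_, fun a b hab => ?_, fun r => ?_⟩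
    · have hγ : 0 ≤ 1 - α - μ * (1 - p r) := by nlinarith [hp r]
      have hq : 0 ≤ 1 - p r := by linarith [hp r]
      have h0 := hnonneg 0
      have h1 := hnonneg (r + 1)
      simp only [rowSum]
      positivity
    · have hstep : α * (1 - p b) * rowSum α μ p h (b + 1) ≤
          α * (1 - p b) * rowSum α μ p h (a + 1) :=
        mul_le_mul_of_nonneg_left (hanti (by lia))
          (mul_nonneg hα0.le (by linarith [hp b]))
      have hgap := mul_nonneg (sub_nonneg.2 (hpmono hab)) (sub_nonneg.2 (hratio (a + 1)))
      simp only [rowSum]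
      linarith
    · have hlower : (1 - α) * rowSum α μ p h 0 ≤ rowSum α μ p (h + 1) r := by
        have := mul_le_mul_of_nonneg_left (hratio (r + 1))
          (show 0 ≤ 1 - p r by linarith [hp r])
        simp only [rowSum]
        linarith
      have hupper : rowSum α μ p (h + 1) 0 ≤ (1 - μ) * rowSum α μ p h 0 := by
        have hle := mul_le_mul_of_nonneg_left (hanti (Nat.zero_le (0 + 1)))
          (mul_nonneg hα0.le (show 0 ≤ 1 - p 0 by linarith [hp 0]))
        have hslack := mul_nonneg (mul_nonneg (sub_nonneg.2 hμα.le) (hp 0).1.le) (hnonneg 0)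
        simp only [rowSum]
        linarith
      have hcoef : 0 ≤ (α - μ) * (1 - α - μ) * rowSum α μ p h 0 :=
        mul_nonneg (mul_nonneg (by linarith) (by linarith)) (hnonneg 0)
      have hl := mul_le_mul_of_nonneg_left hlower hα0.le
      have hu := mul_le_mul_of_nonneg_left hupper hμ0.le
      linarith

/-- Row sums decay geometrically, with rate the zeroth row sum of the matrix. -/
theorem rowSum_le_pow_s8 {α μ : ℝ} {p : ℕ → ℝ}
    (hμ0 : 0 < μ) (hμα : μ < α) (hαμ : α + μ ≤ 1)
    (hp : ∀ r, 0 < p r ∧ p r < 1) (hpmono : Monotone p) (h r : ℕ) :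
    rowSum α μ p h r ≤ (α * (1 - p 0) + (1 - α - μ * (1 - p 0))) ^ h := by
  suffices hzero : rowSum α μ p h 0 ≤ (α * (1 - p 0) + (1 - α - μ * (1 - p 0))) ^ h from
    ((rowSum_nonneg_and_antitone_and_ratio hμ0 hμα hαμ hp hpmono h).2.1 r.zero_le).trans hzero
  induction h with
  | zero => simp [rowSum]
  | succ h ih =>
    have hanti := (rowSum_nonneg_and_antitone_and_ratio hμ0 hμα hαμ hp hpmono h).2.1
    have hle := mul_le_mul_of_nonneg_left (hanti (Nat.zero_le (0 + 1)))
      (mul_nonneg (hμ0.trans hμα).le (show 0 ≤ 1 - p 0 by linarith [hp 0]))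
    have hrate : 0 ≤ α * (1 - p 0) + (1 - α - μ * (1 - p 0)) := by nlinarith [hp 0]
    have := mul_le_mul_of_nonneg_left ih hrate
    rw [pow_succ']
    simp only [rowSum]
    linarith

/-- A series `∑ f (l + 1) c ^ l` that converges still converges after advancing `f`. -/
theorem Summable.mul_pow_advance {f : ℕ → ℝ} {c : ℝ} (hc : c ≠ 0)
    (hf : Summable fun l => f (l + 1) * c ^ l) {δ : ℕ} (hδ : 1 ≤ δ) :
    Summable fun l => f (δ + l) * c ^ l := by
  obtain ⟨k, rfl⟩ := Nat.exists_eq_add_of_le' hδ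
  refine (((summable_nat_add_iff k).2 hf).mul_right (c ^ k)⁻¹).congr fun l => ?_
  rw [show l + k + 1 = k + 1 + l by lia, pow_add]
  field_simp

/-- If f(δ) + λ − g ≥ 0 for a given δ ≥ 1, then the transmit-region
value W(δ, r) = Σ_{l=0}^∞ (f(δ + l) + λ − g)·σ(l, r) is nonincreasing in the
transmission count: W(δ, r') ≤ W(δ, r) whenever r ≤ r'. -/
theorem transmit_value_antitone_in_count
    (α μ lam g : ℝ) (p : ℕ → ℝ) (f : ℕ → ℝ) (W : ℕ → ℕ → ℝ)
    (hμ0 : 0 < μ) (hμα : μ < α) (hα1 : α < 1) (hαμ : α + μ ≤ 1)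
    (hp : ∀ r, 0 < p r ∧ p r < 1) (hpmono : Monotone p)
    (hlam : 0 ≤ lam)
    (hfnonneg : ∀ k, 0 ≤ f k) (hfmono : Monotone f)
    (hfsum : Summable
      (fun l => f (l + 1) * (α * (1 - p 0) + (1 - α - μ * (1 - p 0))) ^ l))
    (hW : ∀ δ r, W δ r = ∑' l : ℕ, (f (δ + l) + lam - g) * rowSum α μ p l r) :
    ∀ δ : ℕ, 1 ≤ δ → 0 ≤ f δ + lam - g →
      ∀ r r' : ℕ, r ≤ r' → W δ r' ≤ W δ r := by
  have hrate0 : 0 < α * (1 - p 0) + (1 - α - μ * (1 - p 0)) := by nlinarith [hp 0]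
  have hrate1 : α * (1 - p 0) + (1 - α - μ * (1 - p 0)) < 1 := by nlinarith [hp 0]
  intro δ hδ hδnonneg r r' hrr'
  have hcost : ∀ l, 0 ≤ f (δ + l) + lam - g := fun l => by
    linarith [hfmono (Nat.le_add_right δ l)]
  have hdom : Summable fun l =>
      (f (δ + l) + lam - g) * (α * (1 - p 0) + (1 - α - μ * (1 - p 0))) ^ l :=
    ((Summable.mul_pow_advance hrate0.ne' hfsum hδ).add
      ((summable_geometric_of_lt_one hrate0.le hrate1).mul_left (lam - g))).congr
      fun l => by ring
  have hrow := rowSum_nonneg_and_antitone_and_ratio hμ0 hμα hαμ hp hpmono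
  have hsum : ∀ s, Summable fun l => (f (δ + l) + lam - g) * rowSum α μ p l s := fun s =>
    hdom.of_nonneg_of_le (fun l => mul_nonneg (hcost l) ((hrow l).1 s)) fun l =>
      mul_le_mul_of_nonneg_left (rowSum_le_pow_s8 hμ0 hμα hαμ hp hpmono l s) (hcost l)
  rw [hW, hW]
  exact (hsum r').tsum_le_tsum
    (fun l => mul_le_mul_of_nonneg_left ((hrow l).2.1 hrr') (hcost l)) (hsum r)
end

section
/- The distortion process under the never-transmit policy has the explicit stationary distribution q given by q(0) = μ/(1 − α + μ) and q(k) = μ(1−α)(1−μ)^{k−1}/(1 − α + μ) for k ≥ 1. Precisely: q(k) ≥ 0 for all k, Σ_{k=0}^∞ q(k) = 1, and q is invariant under the chain's kernel, i.e. q(0) = α·q(0) + μ·Σ_{k=1}^∞ q(k), q(1) = (1−α)·q(0), and q(k+1) = (1−μ)·q(k) for every k ≥ 1. -/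
/-- The distortion process under the never-transmit policy has the
explicit stationary distribution q with q(0) = μ/(1 − α + μ) and
q(k) = μ(1−α)(1−μ)^{k−1}/(1 − α + μ) for k ≥ 1: q is nonnegative, sums to 1, and
is invariant under the chain's kernel, i.e. q(0) = α·q(0) + μ·Σ_{k=1}^∞ q(k),
q(1) = (1−α)·q(0), and q(k+1) = (1−μ)·q(k) for every k ≥ 1. -/
theorem never_transmit_stationary_distribution
    (α μ : ℝ) (q : ℕ → ℝ)
    (hα0 : 0 < α) (hα1 : α < 1) (hμ0 : 0 < μ) (hμ1 : μ < 1)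
    (hq0 : q 0 = μ / (1 - α + μ))
    (hqk : ∀ k : ℕ, 1 ≤ k →
      q k = μ * (1 - α) * (1 - μ) ^ (k - 1) / (1 - α + μ)) :
    (∀ k, 0 ≤ q k) ∧
    HasSum q 1 ∧
    q 0 = α * q 0 + μ * (∑' k : ℕ, q (k + 1)) ∧
    q 1 = (1 - α) * q 0 ∧
    (∀ k : ℕ, 1 ≤ k → q (k + 1) = (1 - μ) * q k) := by
  have hD : 0 < 1 - α + μ := by linarith
  have hsucc : ∀ k, q (k + 1) = μ * (1 - α) / (1 - α + μ) * (1 - μ) ^ k := fun k => by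
    rw [hqk (k + 1) k.succ_pos, Nat.add_sub_cancel]
    ring
  have htail : HasSum (fun k => q (k + 1)) ((1 - α) / (1 - α + μ)) := by
    have h := (hasSum_geometric_of_lt_one (by linarith : 0 ≤ 1 - μ) (by linarith)).mul_left
      (μ * (1 - α) / (1 - α + μ))
    simp only [hsucc]
    have hval : μ * (1 - α) / (1 - α + μ) * (1 - (1 - μ))⁻¹ = (1 - α) / (1 - α + μ) := by
      rw [sub_sub_cancel]
      field_simp
    exact hval ▸ h
  refine ⟨fun k => ?_, ?_, ?_, ?_, fun k hk => ?_⟩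
  · cases k with
    | zero => rw [hq0]; positivity
    | succ k =>
      have h1 : 0 < 1 - α := by linarith
      have h2 : 0 < 1 - μ := by linarith
      rw [hsucc]
      positivity
  · have hval : 1 - q 0 = (1 - α) / (1 - α + μ) := by
      rw [hq0]
      field_simp
      ring
    rw [← hasSum_nat_add_iff' 1, Finset.sum_range_one, hval]
    exact htail
  · rw [htail.tsum_eq, hq0]
    field_simp
    ring
  · rw [hsucc 0, hq0]
    ring
  · obtain ⟨j, rfl⟩ := Nat.exists_eq_add_of_le' hk
    rw [hsucc, hsucc]
    ring
end

section
/- The weights m are summable: for every h ∈ ℕ, Σ_{r=0}^{h} m(h, r) ≤ (1 − μ)^h; consequently the double series Σ_{h=0}^∞ Σ_{r=0}^{h} m(h, r) converges and its sum is at most 1/μ. -/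
/-- m(h, 0): m(0,0) = 1 and
m(h, 0) = Σ_{k=0}^{h−1} γ₂(k)·m(h−k−1, 0)·∏_{j=0}^{k−1} γ₁(j) for h ≥ 1. -/
noncomputable def mZero (γ₁ γ₂ : ℕ → ℝ) : ℕ → ℝ
  | 0 => 1
  | h + 1 =>
      ∑ k ∈ Finset.range (h + 1),
        γ₂ k * mZero γ₁ γ₂ (h - k) * ∏ j ∈ Finset.range k, γ₁ j
  decreasing_by exact Nat.lt_succ_of_le (Nat.sub_le h k)

/-- The weight function m: m(h, r) = m(h−r, 0)·∏_{j=0}^{r−1} γ₁(j) for r ≤ h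
and m(h, r) = 0 for r > h. -/
noncomputable def mWeight (γ₁ γ₂ : ℕ → ℝ) (h r : ℕ) : ℝ :=
  if r ≤ h then mZero γ₁ γ₂ (h - r) * ∏ j ∈ Finset.range r, γ₁ j else 0

theorem mZero_nonneg {γ₁ γ₂ : ℕ → ℝ} (h₁ : ∀ r, 0 ≤ γ₁ r) (h₂ : ∀ r, 0 ≤ γ₂ r) (h : ℕ) :
    0 ≤ mZero γ₁ γ₂ h := by
  induction h using Nat.strong_induction_on with
  | _ h ih =>
    cases h with
    | zero => simp [mZero]
    | succ h =>
      rw [mZero]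
      exact Finset.sum_nonneg fun k _ =>
        mul_nonneg (mul_nonneg (h₂ k) (ih _ (Nat.lt_succ_of_le (Nat.sub_le h k))))
          (Finset.prod_nonneg fun j _ => h₁ j)

theorem mWeight_nonneg {γ₁ γ₂ : ℕ → ℝ} (h₁ : ∀ r, 0 ≤ γ₁ r) (h₂ : ∀ r, 0 ≤ γ₂ r) (h r : ℕ) :
    0 ≤ mWeight γ₁ γ₂ h r := by
  unfold mWeight
  split_ifs
  · exact mul_nonneg (mZero_nonneg h₁ h₂ _) (Finset.prod_nonneg fun j _ => h₁ j)
  · exact le_rfl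

theorem mWeight_succ_succ (γ₁ γ₂ : ℕ → ℝ) (h r : ℕ) :
    mWeight γ₁ γ₂ (h + 1) (r + 1) = γ₁ r * mWeight γ₁ γ₂ h r := by
  simp only [mWeight, Nat.add_le_add_iff_right, Nat.add_sub_add_right, Finset.prod_range_succ]
  split_ifs <;> ring

theorem mWeight_succ_zero (γ₁ γ₂ : ℕ → ℝ) (h : ℕ) :
    mWeight γ₁ γ₂ (h + 1) 0 = ∑ r ∈ Finset.range (h + 1), γ₂ r * mWeight γ₁ γ₂ h r := by
  have h0 : mWeight γ₁ γ₂ (h + 1) 0 = mZero γ₁ γ₂ (h + 1) := by simp [mWeight]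
  rw [h0, mZero]
  refine Finset.sum_congr rfl fun r hr => ?_
  rw [mWeight, if_pos (Nat.lt_succ_iff.mp (Finset.mem_range.mp hr)), mul_assoc]

theorem sum_mWeight_succ (γ₁ γ₂ : ℕ → ℝ) (h : ℕ) :
    ∑ r ∈ Finset.range (h + 1 + 1), mWeight γ₁ γ₂ (h + 1) r =
      ∑ r ∈ Finset.range (h + 1), (γ₁ r + γ₂ r) * mWeight γ₁ γ₂ h r := by
  rw [Finset.sum_range_succ', mWeight_succ_zero, ← Finset.sum_add_distrib]
  refine Finset.sum_congr rfl fun r _ => ?_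
  rw [mWeight_succ_succ, add_mul]

theorem sum_mWeight_le_pow {γ₁ γ₂ : ℕ → ℝ} {c : ℝ} (h₁ : ∀ r, 0 ≤ γ₁ r) (h₂ : ∀ r, 0 ≤ γ₂ r)
    (hc : ∀ r, γ₁ r + γ₂ r ≤ c) (h : ℕ) :
    ∑ r ∈ Finset.range (h + 1), mWeight γ₁ γ₂ h r ≤ c ^ h := by
  have hc0 : 0 ≤ c := (add_nonneg (h₁ 0) (h₂ 0)).trans (hc 0)
  induction h with
  | zero => simp [mWeight, mZero]
  | succ h ih =>
    calc ∑ r ∈ Finset.range (h + 1 + 1), mWeight γ₁ γ₂ (h + 1) r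
        = ∑ r ∈ Finset.range (h + 1), (γ₁ r + γ₂ r) * mWeight γ₁ γ₂ h r :=
          sum_mWeight_succ γ₁ γ₂ h
      _ ≤ ∑ r ∈ Finset.range (h + 1), c * mWeight γ₁ γ₂ h r :=
          Finset.sum_le_sum fun r _ =>
            mul_le_mul_of_nonneg_right (hc r) (mWeight_nonneg h₁ h₂ h r)
      _ = c * ∑ r ∈ Finset.range (h + 1), mWeight γ₁ γ₂ h r := (Finset.mul_sum ..).symm
      _ ≤ c * c ^ h := mul_le_mul_of_nonneg_left ih hc0
      _ = c ^ (h + 1) := (pow_succ' c h).symm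

/-- The weights m are summable: for every h,
Σ_{r=0}^{h} m(h, r) ≤ (1 − μ)^h; consequently the double series
Σ_{h=0}^∞ Σ_{r=0}^{h} m(h, r) converges and its sum is at most 1/μ. -/
theorem mWeight_summable
    (α μ : ℝ) (p : ℕ → ℝ)
    (hμ0 : 0 < μ) (hμα : μ < α) (hα1 : α < 1) (hαμ : α + μ ≤ 1)
    (hp : ∀ r, 0 < p r ∧ p r < 1) (hpmono : Monotone p)
    (γ₁ γ₂ : ℕ → ℝ)
    (hγ₁ : ∀ r, γ₁ r = α * (1 - p r))
    (hγ₂ : ∀ r, γ₂ r = 1 - α - μ * (1 - p r)) :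
    (∀ h : ℕ,
      (∑ r ∈ Finset.range (h + 1), mWeight γ₁ γ₂ h r) ≤ (1 - μ) ^ h) ∧
    Summable (fun h : ℕ => ∑ r ∈ Finset.range (h + 1), mWeight γ₁ γ₂ h r) ∧
    (∑' h : ℕ, ∑ r ∈ Finset.range (h + 1), mWeight γ₁ γ₂ h r) ≤ 1 / μ := by
  have h₁ : ∀ r, 0 ≤ γ₁ r := fun r => by
    rw [hγ₁]
    exact mul_nonneg (hμ0.trans hμα).le (sub_nonneg.mpr (hp r).2.le)
  have h₂ : ∀ r, 0 ≤ γ₂ r := fun r => by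
    rw [hγ₂]
    nlinarith [mul_pos hμ0 (hp r).1]
  have hc : ∀ r, γ₁ r + γ₂ r ≤ 1 - μ := fun r => by
    rw [hγ₁, hγ₂]
    nlinarith [mul_pos (sub_pos.mpr hμα) (hp r).1]
  have hle := sum_mWeight_le_pow h₁ h₂ hc
  have hgeom : HasSum (fun h : ℕ => (1 - μ) ^ h) (1 / μ) := by
    simpa using hasSum_geometric_of_lt_one (r := 1 - μ) (by linarith) (by linarith)
  have hsum : Summable fun h : ℕ => ∑ r ∈ Finset.range (h + 1), mWeight γ₁ γ₂ h r :=
    hgeom.summable.of_nonneg_of_le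
      (fun h => Finset.sum_nonneg fun r _ => mWeight_nonneg h₁ h₂ h r) hle
  exact ⟨hle, hsum, hasSum_le hle hsum.hasSum hgeom⟩
end
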